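/- Fix n ∈ ℕ, n ≥ 1, and a leaf labeling x : {0,1}^n → {0,1}. Let R be uniform on {1,…,n} and, independently given R, let Y be uniform on {0,1}^{n−R}. Then E[(ρ(Y0) − ρ(Y1))²] ≤ 4/n, where Y0 and Y1 denote Y extended by the bit 0 and by the bit 1 respectively. -/

import Mathlib

open scoped Classical

/-- `rho x n i y` is `ρ(y)`: the fraction of 1-labeled leaves of the complete binary tree
of depth `n` whose index extends the length-`i` string `y`.  Strings are encoded
numerically in lexicographic (most-significant-bit-first) order: the length-`i` string
with numeric value `y < 2^i` corresponds to the block of leaves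
`[y·2^{n-i}, (y+1)·2^{n-i})`, and the leaf labeling is `x : ℕ → Bool` (restricted to
indices `< 2^n`). -/
noncomputable def rho (x : ℕ → Bool) (n i y : ℕ) : ℝ :=
  (((Finset.Ico (y * 2 ^ (n - i)) ((y + 1) * 2 ^ (n - i))).filter
      (fun j => x j = true)).card : ℝ) / 2 ^ (n - i)

/-- `Xwalk x n t z` is the martingale value `X(t) = ρ(z_1, …, z_t)` along the leaf `z`:
the density of 1-labels below the length-`t` prefix of the length-`n` string `z`
(numerically, the prefix of `z < 2^n` of length `t` is `z / 2^{n-t}`). -/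
noncomputable def Xwalk (x : ℕ → Bool) (n t z : ℕ) : ℝ :=
  rho x n t (z / 2 ^ (n - t))

theorem rho_split (x : ℕ → Bool) (n i y : ℕ) (hi : i < n) :
    rho x n i y = (rho x n (i + 1) (2 * y) + rho x n (i + 1) (2 * y + 1)) / 2 := by
  obtain ⟨k, rfl⟩ : ∃ k, n = i + 1 + k := ⟨n - (i + 1), by omega⟩
  unfold rho
  have e1 : i + 1 + k - i = k + 1 := by omega
  have e2 : i + 1 + k - (i + 1) = k := by omega
  rw [e1, e2]
  have hu : Finset.Ico (y * 2 ^ (k + 1)) ((y + 1) * 2 ^ (k + 1)) =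
      Finset.Ico (2 * y * 2 ^ k) ((2 * y + 1) * 2 ^ k) ∪
      Finset.Ico ((2 * y + 1) * 2 ^ k) ((2 * y + 1 + 1) * 2 ^ k) := by
    rw [Finset.Ico_union_Ico_eq_Ico]
    · congr 1 <;> ring
    · gcongr; omega
    · gcongr; omega
  rw [hu, Finset.filter_union, Finset.card_union_of_disjoint]
  · push_cast
    rw [pow_succ]
    field_simp
  · exact Finset.disjoint_filter_filter (Finset.Ico_disjoint_Ico_consecutive _ _ _)

theorem rho_nonneg' (x : ℕ → Bool) (n i y : ℕ) : 0 ≤ rho x n i y := by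
  unfold rho; positivity

theorem rho_le_one' (x : ℕ → Bool) (n i y : ℕ) : rho x n i y ≤ 1 := by
  unfold rho
  rw [div_le_one (by positivity)]
  have h := Finset.card_filter_le
    (Finset.Ico (y * 2 ^ (n - i)) ((y + 1) * 2 ^ (n - i))) (fun j => x j = true)
  rw [Nat.card_Ico, ← Nat.sub_mul, Nat.add_sub_cancel_left, one_mul] at h
  exact_mod_cast h

theorem sum_range_two_mul' (f : ℕ → ℝ) (m : ℕ) :
    ∑ y ∈ Finset.range (2 * m), f y = ∑ y ∈ Finset.range m, (f (2 * y) + f (2 * y + 1)) := by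
  induction m with
  | zero => simp
  | succ m ih =>
    rw [show 2 * (m + 1) = 2 * m + 1 + 1 by ring, Finset.sum_range_succ, Finset.sum_range_succ,
      ih, Finset.sum_range_succ]
    ring

/-- Second moment of the density at level `i`. -/
noncomputable def secondMoment (x : ℕ → Bool) (n i : ℕ) : ℝ :=
  (1 / (2 ^ i : ℝ)) * ∑ y ∈ Finset.range (2 ^ i), rho x n i y ^ 2

theorem level_eq (x : ℕ → Bool) (n i : ℕ) (hi : i < n) :
    (1 / (2 ^ i : ℝ)) * ∑ y ∈ Finset.range (2 ^ i),
          (rho x n (i + 1) (2 * y) - rho x n (i + 1) (2 * y + 1)) ^ 2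
      = 4 * (secondMoment x n (i + 1) - secondMoment x n i) := by
  unfold secondMoment
  rw [pow_succ' (2 : ℕ) i, sum_range_two_mul', pow_succ' (2 : ℝ) i]
  have h : ∑ y ∈ Finset.range (2 ^ i),
          (rho x n (i + 1) (2 * y) - rho x n (i + 1) (2 * y + 1)) ^ 2 =
      2 * ∑ y ∈ Finset.range (2 ^ i),
          (rho x n (i + 1) (2 * y) ^ 2 + rho x n (i + 1) (2 * y + 1) ^ 2)
      - 4 * ∑ y ∈ Finset.range (2 ^ i), rho x n i y ^ 2 := by
    rw [Finset.mul_sum, Finset.mul_sum, ← Finset.sum_sub_distrib]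
    refine Finset.sum_congr rfl fun y _ => ?_
    rw [rho_split x n i y hi]
    ring
  rw [h]
  field_simp
  ring

theorem secondMoment_nonneg (x : ℕ → Bool) (n i : ℕ) : 0 ≤ secondMoment x n i := by
  unfold secondMoment; positivity

theorem secondMoment_le_one (x : ℕ → Bool) (n i : ℕ) : secondMoment x n i ≤ 1 := by
  unfold secondMoment
  have h : ∑ y ∈ Finset.range (2 ^ i), rho x n i y ^ 2 ≤ ∑ y ∈ Finset.range (2 ^ i), (1 : ℝ) :=
    Finset.sum_le_sum fun y _ => pow_le_one₀ (rho_nonneg' x n i y) (rho_le_one' x n i y)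
  simp only [Finset.sum_const, Finset.card_range, nsmul_eq_mul, mul_one] at h
  push_cast at h
  rw [one_div, inv_mul_le_iff₀ (by positivity)]
  linarith

/-- Expected squared deviation of sibling densities: for `R` uniform on `{1, …, n}` and,
given `R`, `Y` uniform on `{0,1}^{n-R}`, one has `E[(ρ(Y0) - ρ(Y1))²] ≤ 4/n`.
(Numerically, the string `Y` of length `n - r` is uniform on `{0, …, 2^{n-r} - 1}`,
and `Y0, Y1` have numeric values `2Y, 2Y + 1` at level `n - r + 1`.) -/
theorem sibling_density_square_bound (n : ℕ) (hn : 1 ≤ n) (x : ℕ → Bool) :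
    (1 / (n : ℝ)) * ∑ r ∈ Finset.Icc 1 n,
        (1 / (2 ^ (n - r) : ℝ)) * ∑ y ∈ Finset.range (2 ^ (n - r)),
          (rho x n (n - r + 1) (2 * y) - rho x n (n - r + 1) (2 * y + 1)) ^ 2
      ≤ 4 / n := by
  have hs : ∑ r ∈ Finset.Icc 1 n,
        (1 / (2 ^ (n - r) : ℝ)) * ∑ y ∈ Finset.range (2 ^ (n - r)),
          (rho x n (n - r + 1) (2 * y) - rho x n (n - r + 1) (2 * y + 1)) ^ 2
      = ∑ i ∈ Finset.range n, 4 * (secondMoment x n (i + 1) - secondMoment x n i) := by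
    refine Finset.sum_bij' (fun r _ => n - r) (fun i _ => n - i) ?_ ?_ ?_ ?_ ?_
    · intro r hr; simp only [Finset.mem_Icc, Finset.mem_range] at *; omega
    · intro r hr; simp only [Finset.mem_Icc, Finset.mem_range] at *; omega
    · intro r hr; simp only [Finset.mem_Icc] at *; omega
    · intro r hr; simp only [Finset.mem_range] at *; omega
    · intro r hr
      simp only [Finset.mem_Icc] at hr
      exact level_eq x n (n - r) (by omega)
  rw [hs, ← Finset.mul_sum, Finset.sum_range_sub, one_div, inv_mul_eq_div]
  have h0 := secondMoment_nonneg x n 0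
  have h1 := secondMoment_le_one x n n
  gcongr
  linarith
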